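/- With D the Subset Sum MDP of the context, built from positive integers s₁,…,sₙ and N ∈ ℕ with N ≤ T = s₁+⋯+sₙ: there exists a subset P ⊆ {1,…,n} with Σ_{i∈P} sᵢ = N if and only if there exists a memoryless strategy α such that the probabilistic bisimilarity distance satisfies d_pb(s,t) < 1 in D(α). -/

import Mathlib

open Matrix

/-- A labelled Markov decision process: a partial probabilistic transition function
`phi : S × A ⇀ (S → ℝ)` and a labelling function. -/
structure MDP (S A L : Type) where
  phi : S → A → Option (S → ℝ)
  label : S → L

namespace MDP

variable {S A L : Type} [Fintype S] [Fintype A] [DecidableEq S]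

/-- The MDP data is well-formed: every state has an available action, and every
defined `phi s m` is a probability distribution on `S`. -/
def IsValid (D : MDP S A L) : Prop :=
  (∀ s, ∃ m, (D.phi s m).isSome) ∧
    ∀ s m d, D.phi s m = some d → (∀ t, 0 ≤ d t) ∧ (∑ t, d t) = 1

/-- Transition probabilities, with `0` for unavailable actions. -/
def trans (D : MDP S A L) (s : S) (m : A) : S → ℝ :=
  (D.phi s m).getD 0

/-- A memoryless strategy: for each state a probability distribution on the
available actions. -/
def IsStrategy (D : MDP S A L) (α : S → A → ℝ) : Prop :=
  ∀ s, (∀ m, 0 ≤ α s m) ∧ (∑ m, α s m) = 1 ∧ ∀ m, D.phi s m = none → α s m = 0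

/-- Transition probabilities of the induced labelled Markov chain `D(α)`. -/
def tau (D : MDP S A L) (α : S → A → ℝ) (s t : S) : ℝ :=
  ∑ m, α s m * D.trans s m t

/-- The matrix `M_α(a)`. -/
def Mmat [DecidableEq L] (D : MDP S A L) (α : S → A → ℝ) (a : L) : Matrix S S ℝ :=
  Matrix.of fun s t => if D.label s = a then D.tau α s t else 0

/-- The matrix `M_α(w)` for a word `w ∈ L*` (identity for the empty word). -/
def Mword [DecidableEq L] (D : MDP S A L) (α : S → A → ℝ) (w : List L) : Matrix S S ℝ :=
  (w.map (D.Mmat α)).prod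

/-- A memoryless deterministic (MD) strategy, viewed as a function `S → A`
choosing an available action in each state. -/
def IsMD (D : MDP S A L) (β : S → A) : Prop := ∀ s, (D.phi s (β s)).isSome

/-- The memoryless strategy corresponding to an MD strategy. -/
def mdStrat [DecidableEq A] (β : S → A) : S → A → ℝ :=
  fun s m => if m = β s then 1 else 0

end MDP

namespace MDP

variable {S A L : Type} [Fintype S] [Fintype A] [DecidableEq S]

/-- `ω` is a coupling of `μ` and `ν`: a joint distribution with marginals `μ`, `ν`. -/
def IsCoupling [Fintype S] (ω : S → S → ℝ) (μ ν : S → ℝ) : Prop :=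
  (∀ u v, 0 ≤ ω u v) ∧ (∀ u, (∑ v, ω u v) = μ u) ∧ ∀ v, (∑ u, ω u v) = ν v

open Classical in
/-- The map `Δ` on `[0,1]^{S×S}` whose least fixed point is the probabilistic
bisimilarity distance in the labelled Markov chain `D(α)`:
`Δ(d)(s,t) = 1` if `ℓ(s) ≠ ℓ(t)`, and otherwise the minimum over couplings `ω` of
`τ(s)` and `τ(t)` of `Σ_{u,v} ω(u,v)·d(u,v)`. -/
noncomputable def Delta (D : MDP S A L) (α : S → A → ℝ) (d : S → S → ℝ) :
    S → S → ℝ := fun s t =>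
  if D.label s ≠ D.label t then 1
  else sInf {x | ∃ ω, IsCoupling ω (D.tau α s) (D.tau α t) ∧
    x = ∑ u, ∑ v, ω u v * d u v}

/-- `d` is the least fixed point of `Δ` on `[0,1]^{S×S}`, i.e. the probabilistic
bisimilarity distance `d_pb` of the labelled Markov chain `D(α)`. -/
def IsBisimDist (D : MDP S A L) (α : S → A → ℝ) (d : S → S → ℝ) : Prop :=
  (∀ s t, d s t ∈ Set.Icc (0 : ℝ) 1) ∧ D.Delta α d = d ∧
    ∀ d', (∀ s t, d' s t ∈ Set.Icc (0 : ℝ) 1) → D.Delta α d' = d' →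
      ∀ s t, d s t ≤ d' s t

end MDP

/-- The Dirac distribution on a state. -/
def dirac {S : Type} [DecidableEq S] (x : S) : S → ℝ := fun y => if y = x then 1 else 0

/-- States of the Subset Sum MDP: `s, u₁,…,uₙ, s_a, s_b, t, t₁, t₂, t_a, t_b`. -/
inductive SubState (n : ℕ) where
  | s | u (i : Fin n) | sa | sb | t | t1 | t2 | ta | tb
deriving DecidableEq, Fintype

/-- The transition function of the Subset Sum MDP built from `s₁,…,sₙ` and `N`
(with `T = s₁ + ⋯ + sₙ`); each `uᵢ` has two actions (`false` to `s_a`, `true` to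
`s_b`), all other states a single action `false`. -/
noncomputable def subPhi (n : ℕ) (sv : Fin n → ℕ) (N : ℕ) :
    SubState n → Bool → Option (SubState n → ℝ) :=
  fun st act =>
    match st, act with
    | .s, false =>
        some fun x => match x with
          | .u i => (sv i : ℝ) / ((∑ k, sv k : ℕ) : ℝ)
          | _ => 0
    | .u _, false => some (dirac .sa)
    | .u _, true => some (dirac .sb)
    | .sa, false => some (dirac .s)
    | .sb, false => some (dirac .s)
    | .t, false =>
        some fun x => match x with
          | .t1 => (N : ℝ) / ((∑ k, sv k : ℕ) : ℝ)
          | .t2 => 1 - (N : ℝ) / ((∑ k, sv k : ℕ) : ℝ)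
          | _ => 0
    | .t1, false => some (dirac .ta)
    | .t2, false => some (dirac .tb)
    | .ta, false => some (dirac .t)
    | .tb, false => some (dirac .t)
    | _, _ => none

/-- The labelling function (labels from `Bool`, where `true` is the label `b`):
`s_b` and `t_b` carry label `b`, all other states label `a`. -/
def subLabel (n : ℕ) : SubState n → Bool
  | .sb => true
  | .tb => true
  | _ => false

/-- The Subset Sum MDP. -/
noncomputable def subMDP (n : ℕ) (sv : Fin n → ℕ) (N : ℕ) :
    MDP (SubState n) Bool Bool :=
  ⟨subPhi n sv N, subLabel n⟩

namespace MDP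

theorem tau_eq_sum_bool {S L : Type} {D : MDP S Bool L} {α : S → Bool → ℝ} (x : S) :
    D.tau α x = fun y => α x false * D.trans x false y + α x true * D.trans x true y := by
  funext y
  simp [tau, add_comm]

theorem tau_eq_of_phi {S L : Type} {D : MDP S Bool L} {α : S → Bool → ℝ} (hα : D.IsStrategy α) {x : S}
    {μ : S → ℝ} (h : D.phi x true = none) (hμ : D.phi x false = some μ) : D.tau α x = μ := by
  obtain ⟨-, h₁, h₂⟩ := hα x
  have ht := h₂ _ h
  rw [Fintype.sum_bool, ht, zero_add] at h₁
  rw [tau_eq_sum_bool, ht, h₁]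
  simp [trans, hμ]

section General

variable {S A L : Type} [Fintype S] [Fintype A]

theorem IsCoupling.prod {μ ν : S → ℝ} (hμ : (∀ u, 0 ≤ μ u) ∧ ∑ u, μ u = 1)
    (hν : (∀ u, 0 ≤ ν u) ∧ ∑ u, ν u = 1) : IsCoupling (fun u v => μ u * ν v) μ ν := by
  refine ⟨fun u v => mul_nonneg (hμ.1 u) (hν.1 v), fun u => ?_, fun v => ?_⟩
  · rw [← Finset.mul_sum, hν.2, mul_one]
  · rw [← Finset.sum_mul, hμ.2, one_mul]

/-- Two distributions giving the same mass to every fibre of `c` have a coupling supported on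
the pairs that lie in a common fibre. -/
theorem exists_isCoupling_of_fiber_sum_eq {K : Type} [DecidableEq K] (c : S → K) {μ ν : S → ℝ}
    (hμ : ∀ u, 0 ≤ μ u) (hν : ∀ u, 0 ≤ ν u)
    (h : ∀ k, (∑ u, if c u = k then μ u else 0) = ∑ u, if c u = k then ν u else 0) :
    ∃ ω, IsCoupling ω μ ν ∧ ∀ u v, c u ≠ c v → ω u v = 0 := by
  set m : K → ℝ := fun k => ∑ u, if c u = k then μ u else 0 with hm
  have le_mass : ∀ ρ : S → ℝ, (∀ u, 0 ≤ ρ u) → ∀ u,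
      ρ u ≤ ∑ v, if c v = c u then ρ v else 0 := fun ρ hρ u => by
    have := Finset.single_le_sum (f := fun v => if c v = c u then ρ v else 0)
      (fun v _ => by split_ifs <;> simp [hρ]) (Finset.mem_univ u)
    simpa using this
  have m_nonneg : ∀ k, 0 ≤ m k := fun k =>
    Finset.sum_nonneg fun u _ => by split_ifs <;> simp [hμ]
  have cancel : ∀ r k, 0 ≤ r → r ≤ m k → r * m k / m k = r := fun r k h₁ h₂ => by
    by_cases hk : m k = 0
    · rw [hk] at h₂ ⊢
      simp [le_antisymm h₂ h₁]
    · rw [mul_div_cancel_right₀ _ hk]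
  refine ⟨fun u v => if c v = c u then μ u * ν v / m (c u) else 0,
    ⟨fun u v => ?_, fun u => ?_, fun v => ?_⟩, fun u v huv => ?_⟩
  · dsimp only
    split_ifs
    · exact div_nonneg (mul_nonneg (hμ u) (hν v)) (m_nonneg _)
    · exact le_rfl
  · have : ∀ v, (if c v = c u then μ u * ν v / m (c u) else 0) =
        μ u * (if c v = c u then ν v else 0) / m (c u) := fun v => by split_ifs <;> simp
    simp only [this]
    rw [← Finset.sum_div, ← Finset.mul_sum, ← h]
    exact cancel _ _ (hμ u) (le_mass μ hμ u)
  · have : ∀ u, (if c v = c u then μ u * ν v / m (c u) else 0) =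
        ν v * (if c u = c v then μ u else 0) / m (c v) := fun u => by
      by_cases huv : c u = c v
      · simp [huv, mul_comm]
      · simp [huv, Ne.symm huv]
    simp only [this]
    rw [← Finset.sum_div, ← Finset.mul_sum]
    refine cancel _ _ (hν v) ?_
    rw [hm]
    dsimp only
    rw [h]
    exact le_mass ν hν v
  · simp [Ne.symm huv]

theorem tau_isDistr {D : MDP S A L} (hD : D.IsValid) {α : S → A → ℝ} (hα : D.IsStrategy α)
    (x : S) : (∀ y, 0 ≤ D.tau α x y) ∧ ∑ y, D.tau α x y = 1 := by
  obtain ⟨h₀, h₁, h₂⟩ := hα x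
  have key : ∀ m, (∀ y, 0 ≤ α x m * D.trans x m y) ∧
      ∑ y, α x m * D.trans x m y = α x m := fun m => by
    cases hm : D.phi x m with
    | none => simp [h₂ m hm]
    | some μ =>
      obtain ⟨hμ₀, hμ₁⟩ := hD.2 x m μ hm
      have : D.trans x m = μ := by simp [trans, hm]
      rw [this, ← Finset.mul_sum, hμ₁, mul_one]
      exact ⟨fun y => mul_nonneg (h₀ m) (hμ₀ y), rfl⟩
  refine ⟨fun y => Finset.sum_nonneg fun m _ => (key m).1 y, ?_⟩
  unfold tau
  rw [Finset.sum_comm, Finset.sum_congr rfl fun m _ => (key m).2, h₁]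

variable {D : MDP S A L} {α : S → A → ℝ}

theorem Delta_le_of_isCoupling {d : S → S → ℝ} (hd : ∀ u v, 0 ≤ d u v) {x y : S}
    (hxy : D.label x = D.label y) {ω : S → S → ℝ}
    (hω : IsCoupling ω (D.tau α x) (D.tau α y)) :
    D.Delta α d x y ≤ ∑ u, ∑ v, ω u v * d u v := by
  rw [Delta, if_neg (by simpa using hxy)]
  refine csInf_le ⟨0, ?_⟩ ⟨ω, hω, rfl⟩
  rintro _ ⟨ω', hω', rfl⟩
  exact Finset.sum_nonneg fun u _ => Finset.sum_nonneg fun v _ => mul_nonneg (hω'.1 u v) (hd u v)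

theorem exists_isCoupling_lt (hτ : ∀ x, (∀ y, 0 ≤ D.tau α x y) ∧ ∑ y, D.tau α x y = 1)
    {d : S → S → ℝ} {x y : S} (hxy : D.label x = D.label y) {r : ℝ} (hr : D.Delta α d x y < r) :
    ∃ ω, IsCoupling ω (D.tau α x) (D.tau α y) ∧ ∑ u, ∑ v, ω u v * d u v < r := by
  rw [Delta, if_neg (by simpa using hxy)] at hr
  have hne : {r | ∃ ω, IsCoupling ω (D.tau α x) (D.tau α y) ∧
      r = ∑ u, ∑ v, ω u v * d u v}.Nonempty := ⟨_, _, IsCoupling.prod (hτ x) (hτ y), rfl⟩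
  obtain ⟨_, ⟨ω, hω, rfl⟩, h⟩ := exists_lt_of_csInf_lt hne hr
  exact ⟨ω, hω, h⟩

theorem Delta_mem_Icc (hτ : ∀ x, (∀ y, 0 ≤ D.tau α x y) ∧ ∑ y, D.tau α x y = 1)
    {d : S → S → ℝ} (hd : ∀ x y, d x y ∈ Set.Icc (0 : ℝ) 1) (x y : S) :
    D.Delta α d x y ∈ Set.Icc (0 : ℝ) 1 := by
  by_cases hxy : D.label x = D.label y
  · refine ⟨?_, ?_⟩
    · rw [Delta, if_neg (by simpa using hxy)]
      refine Real.sInf_nonneg ?_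
      rintro _ ⟨ω, hω, rfl⟩
      exact Finset.sum_nonneg fun u _ => Finset.sum_nonneg fun v _ =>
        mul_nonneg (hω.1 u v) (hd u v).1
    · have hω := IsCoupling.prod (hτ x) (hτ y)
      refine (Delta_le_of_isCoupling (fun u v => (hd u v).1) hxy hω).trans ?_
      calc _ ≤ ∑ u, ∑ v, D.tau α x u * D.tau α y v :=
            Finset.sum_le_sum fun u _ => Finset.sum_le_sum fun v _ =>
              mul_le_of_le_one_right (hω.1 u v) (hd u v).2
        _ = 1 := by rw [Finset.sum_congr rfl fun u _ => hω.2.1 u, (hτ x).2]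
  · rw [Delta, if_pos hxy]
    simp

theorem Delta_mono (hτ : ∀ x, (∀ y, 0 ≤ D.tau α x y) ∧ ∑ y, D.tau α x y = 1)
    {d e : S → S → ℝ} (hd : ∀ x y, 0 ≤ d x y) (hde : ∀ x y, d x y ≤ e x y) (x y : S) :
    D.Delta α d x y ≤ D.Delta α e x y := by
  by_cases hxy : D.label x = D.label y
  · refine le_of_forall_gt fun r hr => ?_
    obtain ⟨ω, hω, h⟩ := exists_isCoupling_lt hτ hxy hr
    refine ((Delta_le_of_isCoupling hd hxy hω).trans ?_).trans_lt h
    exact Finset.sum_le_sum fun u _ => Finset.sum_le_sum fun v _ =>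
      mul_le_mul_of_nonneg_left (hde u v) (hω.1 u v)
  · rw [Delta, Delta, if_pos hxy, if_pos hxy]

/-- The bisimilarity distance exists and lies below every prefixed point of `Δ`. -/
theorem exists_isBisimDist (hτ : ∀ x, (∀ y, 0 ≤ D.tau α x y) ∧ ∑ y, D.tau α x y = 1) :
    ∃ d, D.IsBisimDist α d ∧ ∀ e : S → S → ℝ, (∀ x y, e x y ∈ Set.Icc (0 : ℝ) 1) →
      (∀ x y, D.Delta α e x y ≤ e x y) → ∀ x y, d x y ≤ e x y := by
  let F : (S → S → Set.Icc (0 : ℝ) 1) →o (S → S → Set.Icc (0 : ℝ) 1) :=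
    { toFun := fun d x y => ⟨D.Delta α (fun u v => d u v) x y,
        Delta_mem_Icc hτ (fun u v => (d u v).2) x y⟩
      monotone' := fun d e hde x y =>
        Delta_mono hτ (fun u v => (d u v).2.1) (fun u v => hde u v) x y }
  have le_of_prefixed : ∀ e : S → S → ℝ, (∀ x y, e x y ∈ Set.Icc (0 : ℝ) 1) →
      (∀ x y, D.Delta α e x y ≤ e x y) → ∀ x y, (F.lfp x y : ℝ) ≤ e x y :=
    fun e he h x y =>
      (F.lfp_le (a := fun x y => ⟨e x y, he x y⟩) fun x y => h x y : F.lfp ≤ _) x y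
  refine ⟨fun x y => F.lfp x y, ⟨fun x y => (F.lfp x y).2, ?_, ?_⟩, le_of_prefixed⟩
  · funext x y
    exact congrArg Subtype.val (congrFun (congrFun F.map_lfp x) y)
  · exact fun e he h => le_of_prefixed e he fun x y => (congrFun (congrFun h x) y).le

theorem Delta_le_of_fiber_sum_eq (hτ : ∀ x, (∀ y, 0 ≤ D.tau α x y) ∧ ∑ y, D.tau α x y = 1)
    {K : Type} [DecidableEq K] (c : S → K) (hlabel : ∀ x y, c x = c y → D.label x = D.label y)
    (h : ∀ x y, c x = c y → ∀ k, (∑ u, if c u = k then D.tau α x u else 0) =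
      ∑ u, if c u = k then D.tau α y u else 0) (x y : S) :
    D.Delta α (fun x y => if c x = c y then 0 else 1) x y ≤ if c x = c y then 0 else 1 := by
  have mem_Icc : ∀ x y, (if c x = c y then (0 : ℝ) else 1) ∈ Set.Icc (0 : ℝ) 1 := fun x y => by
    split_ifs <;> simp
  by_cases hxy : c x = c y
  · obtain ⟨ω, hω, hω₀⟩ := exists_isCoupling_of_fiber_sum_eq c (hτ x).1 (hτ y).1 (h x y hxy)
    refine (Delta_le_of_isCoupling (fun u v => (mem_Icc u v).1) (hlabel x y hxy) hω).trans ?_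
    rw [if_pos hxy]
    refine Finset.sum_nonpos fun u _ => Finset.sum_nonpos fun v _ => ?_
    by_cases huv : c u = c v
    · simp [huv]
    · simp [hω₀ u v huv]
  · rw [if_neg hxy]
    exact (Delta_mem_Icc hτ mem_Icc x y).2

theorem IsCoupling.eq_zero_left {ω : S → S → ℝ} {μ ν : S → ℝ} (hω : IsCoupling ω μ ν) {u : S}
    (hu : μ u = 0) (v : S) : ω u v = 0 :=
  (Finset.sum_eq_zero_iff_of_nonneg fun v _ => hω.1 u v).1 ((hω.2.1 u).trans hu) v
    (Finset.mem_univ v)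

theorem IsCoupling.eq_zero_right {ω : S → S → ℝ} {μ ν : S → ℝ} (hω : IsCoupling ω μ ν) {v : S}
    (hv : ν v = 0) (u : S) : ω u v = 0 :=
  (Finset.sum_eq_zero_iff_of_nonneg fun u _ => hω.1 u v).1 ((hω.2.2 v).trans hv) u
    (Finset.mem_univ u)

theorem sum_le_Delta_of_tau_eq_dirac [DecidableEq S]
    (hτ : ∀ x, (∀ y, 0 ≤ D.tau α x y) ∧ ∑ y, D.tau α x y = 1) {d : S → S → ℝ} {x y z : S}
    (hxy : D.label x = D.label y) (hy : D.tau α y = dirac z) :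
    ∑ u, D.tau α x u * d u z ≤ D.Delta α d x y := by
  refine le_of_forall_gt fun r hr => ?_
  obtain ⟨ω, hω, h⟩ := exists_isCoupling_lt hτ hxy hr
  refine lt_of_eq_of_lt (Finset.sum_congr rfl fun u _ => ?_) h
  have off : ∀ v, v ≠ z → ω u v = 0 := fun v hv =>
    hω.eq_zero_right (by simp [hy, dirac, hv]) u
  rw [← hω.2.1 u, Finset.sum_eq_single_of_mem z (Finset.mem_univ z) fun v _ hv => off v hv,
    Finset.sum_eq_single_of_mem z (Finset.mem_univ z) fun v _ hv => by rw [off v hv, zero_mul]]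

end General

end MDP

theorem SubState.sum_univ {n : ℕ} (f : SubState n → ℝ) :
    ∑ x, f x = (∑ i, f (.u i)) + (f .s + f .sa + f .sb + f .t + f .t1 + f .t2 + f .ta + f .tb) := by
  have huniv : (Finset.univ : Finset (SubState n)) =
      Finset.univ.image SubState.u ∪ {.s, .sa, .sb, .t, .t1, .t2, .ta, .tb} := by
    ext x
    cases x <;> simp
  rw [huniv, Finset.sum_union, Finset.sum_image]
  · simp [add_assoc]
  · intro i _ j _ h
    simpa using h
  · rw [Finset.disjoint_left]
    simp

section SubsetSum

variable {n : ℕ} {sv : Fin n → ℕ} {N : ℕ}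

theorem sum_pos_of_forall_pos (hn : 1 ≤ n) (hsv : ∀ i, 0 < sv i) : 0 < ∑ i, sv i :=
  Finset.sum_pos (fun i _ => hsv i) ⟨⟨0, hn⟩, Finset.mem_univ _⟩

theorem dirac_isDistr {S : Type} [Fintype S] [DecidableEq S] (x : S) :
    (∀ y, 0 ≤ dirac x y) ∧ ∑ y, dirac x y = 1 := by
  refine ⟨fun y => ?_, by simp [dirac]⟩
  unfold dirac
  split_ifs <;> simp

theorem subMDP_isValid (hT : 0 < ∑ i, sv i) (hN : N ≤ ∑ i, sv i) : (subMDP n sv N).IsValid := by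
  have hT' : (0 : ℝ) < ((∑ i, sv i : ℕ) : ℝ) := by exact_mod_cast hT
  have hN' : (N : ℝ) / ((∑ i, sv i : ℕ) : ℝ) ≤ 1 := by
    rw [div_le_one hT']
    exact_mod_cast hN
  refine ⟨fun x => ⟨false, by cases x <;> rfl⟩, fun x m μ h => ?_⟩
  cases x <;> cases m <;> simp only [subMDP, subPhi, Option.some.injEq, reduceCtorEq] at h <;>
    subst h <;> try exact dirac_isDistr _
  · refine ⟨fun y => ?_, ?_⟩
    · cases y <;> simp only [le_refl]
      positivity
    · rw [SubState.sum_univ]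
      simp only [← Finset.sum_div, add_zero]
      rw [← Nat.cast_sum, div_self hT'.ne']
  · refine ⟨fun y => ?_, ?_⟩
    · cases y <;> simp only [le_refl]
      · positivity
      · linarith
    · rw [SubState.sum_univ]
      simp

theorem tau_subMDP_u (α : SubState n → Bool → ℝ) (i : Fin n) :
    (subMDP n sv N).tau α (.u i) =
      fun y => α (.u i) false * dirac .sa y + α (.u i) true * dirac .sb y :=
  MDP.tau_eq_sum_bool _

/-- The bisimulation classes of the chain in which `uᵢ` moves to `s_a` exactly when `i ∈ P`. -/
def subClass (P : Finset (Fin n)) : SubState n → Fin 5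
  | .s | .t => 0
  | .u i => if i ∈ P then 1 else 2
  | .t1 => 1
  | .t2 => 2
  | .sa | .ta => 3
  | .sb | .tb => 4

/-- The deterministic choice in which `uᵢ` moves to `s_a` exactly when `i ∈ P`. -/
def subChoice (P : Finset (Fin n)) : SubState n → Bool
  | .u i => decide (i ∉ P)
  | _ => false

theorem subMDP_isStrategy_mdStrat (P : Finset (Fin n)) :
    (subMDP n sv N).IsStrategy (MDP.mdStrat (subChoice P)) := by
  refine fun x => ⟨fun m => ?_, by simp [MDP.mdStrat], fun m hm => ?_⟩
  · unfold MDP.mdStrat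
    split_ifs <;> simp
  · cases x <;> cases m <;> simp_all [subMDP, subPhi, MDP.mdStrat, subChoice]

theorem tau_mdStrat_u (P : Finset (Fin n)) (i : Fin n) :
    (subMDP n sv N).tau (MDP.mdStrat (subChoice P)) (.u i) =
      dirac (if i ∈ P then .sa else .sb) := by
  rw [tau_subMDP_u]
  funext y
  by_cases hi : i ∈ P <;> simp [MDP.mdStrat, subChoice, hi]

theorem fiber_sum_dirac {S K : Type} [Fintype S] [DecidableEq S] [DecidableEq K] (c : S → K)
    (x : S) (k : K) : (∑ u, if c u = k then dirac x u else 0) = if c x = k then 1 else 0 := by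
  rw [Finset.sum_eq_single_of_mem x (Finset.mem_univ x)] <;> simp +contextual [dirac]

theorem fiber_sum_tau_mdStrat (hT : 0 < ∑ i, sv i) {P : Finset (Fin n)} (hP : ∑ i ∈ P, sv i = N)
    (x : SubState n) (k : Fin 5) :
    (∑ u, if subClass P u = k then
        (subMDP n sv N).tau (MDP.mdStrat (subChoice P)) x u else 0) =
      ![![0, (N : ℝ) / ((∑ i, sv i : ℕ) : ℝ), 1 - (N : ℝ) / ((∑ i, sv i : ℕ) : ℝ), 0, 0] k,
        if 3 = k then 1 else 0, if 4 = k then 1 else 0, if 0 = k then 1 else 0,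
        if 0 = k then 1 else 0] (subClass P x) := by
  have hα := subMDP_isStrategy_mdStrat (sv := sv) (N := N) P
  have hT' : ((∑ i, sv i : ℕ) : ℝ) ≠ 0 := by exact_mod_cast hT.ne'
  cases x with
  | s =>
    rw [MDP.tau_eq_of_phi hα (x := .s) rfl rfl, SubState.sum_univ]
    have h₁ : (∑ i, if i ∈ P then (sv i : ℝ) / ((∑ k, sv k : ℕ) : ℝ) else 0) =
        (N : ℝ) / ((∑ k, sv k : ℕ) : ℝ) := by
      rw [← hP, Finset.sum_ite_mem, Finset.univ_inter, ← Finset.sum_div, ← Nat.cast_sum]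
    have h₂ : (∑ i, if i ∈ P then 0 else (sv i : ℝ) / ((∑ k, sv k : ℕ) : ℝ)) =
        1 - (N : ℝ) / ((∑ k, sv k : ℕ) : ℝ) := by
      rw [← h₁, eq_sub_iff_add_eq, ← Finset.sum_add_distrib]
      have : ∀ i, ((if i ∈ P then 0 else (sv i : ℝ) / ((∑ k, sv k : ℕ) : ℝ)) +
          if i ∈ P then (sv i : ℝ) / ((∑ k, sv k : ℕ) : ℝ) else 0) =
          (sv i : ℝ) / ((∑ k, sv k : ℕ) : ℝ) := fun i => by split_ifs <;> simp
      rw [Finset.sum_congr rfl fun i _ => this i, ← Finset.sum_div, ← Nat.cast_sum, div_self hT']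
    have hcls : ∀ i, subClass P (.u i) = if i ∈ P then 1 else 2 := fun i => rfl
    have hs : subClass P (.s) = 0 := rfl
    simp only [ite_self, add_zero, hcls, hs]
    fin_cases k
    · refine Finset.sum_eq_zero fun i _ => if_neg ?_
      split_ifs <;> decide
    · refine Eq.trans (Finset.sum_congr rfl fun i _ => ?_) h₁
      by_cases hi : i ∈ P <;> simp [hi]
    · refine Eq.trans (Finset.sum_congr rfl fun i _ => ?_) h₂
      by_cases hi : i ∈ P <;> simp [hi]
    · refine Finset.sum_eq_zero fun i _ => if_neg ?_
      split_ifs <;> decide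
    · refine Finset.sum_eq_zero fun i _ => if_neg ?_
      split_ifs <;> decide
  | t =>
    rw [MDP.tau_eq_of_phi hα (x := .t) rfl rfl, SubState.sum_univ]
    simp only [ite_self, Finset.sum_const_zero]
    fin_cases k <;> simp [subClass]
  | u i =>
    rw [tau_mdStrat_u, fiber_sum_dirac]
    by_cases hi : i ∈ P <;> simp [subClass, hi]
  | sa => rw [MDP.tau_eq_of_phi hα (x := .sa) rfl rfl, fiber_sum_dirac]; rfl
  | sb => rw [MDP.tau_eq_of_phi hα (x := .sb) rfl rfl, fiber_sum_dirac]; rfl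
  | t1 => rw [MDP.tau_eq_of_phi hα (x := .t1) rfl rfl, fiber_sum_dirac]; rfl
  | t2 => rw [MDP.tau_eq_of_phi hα (x := .t2) rfl rfl, fiber_sum_dirac]; rfl
  | ta => rw [MDP.tau_eq_of_phi hα (x := .ta) rfl rfl, fiber_sum_dirac]; rfl
  | tb => rw [MDP.tau_eq_of_phi hα (x := .tb) rfl rfl, fiber_sum_dirac]; rfl

theorem subLabel_eq_of_subClass_eq (P : Finset (Fin n)) (x y : SubState n)
    (h : subClass P x = subClass P y) : subLabel n x = subLabel n y := by
  have key : ∀ x, subLabel n x = decide (subClass P x = 4) := fun x => by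
    cases x with
    | u i => by_cases hi : i ∈ P <;> simp [subLabel, subClass, hi]
    | _ => rfl
  rw [key, key, h]

/-- If a fixed point of `Δ` puts `s` and `t` at distance less than `1`, then there are couplings
of the successors of `s` and `t` for which the probability of reaching differently labelled states
in two steps is arbitrarily small. -/
theorem exists_split_lt (hT : 0 < ∑ i, sv i) (hN : N ≤ ∑ i, sv i)
    {α : SubState n → Bool → ℝ} (hα : (subMDP n sv N).IsStrategy α) {d : SubState n → SubState n → ℝ}
    (hd : (subMDP n sv N).Delta α d = d) (hlt : d .s .t < 1) {ε : ℝ} (hε : 0 < ε) :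
    ∃ a b : Fin n → ℝ, (∀ i, 0 ≤ a i) ∧ (∀ i, 0 ≤ b i) ∧
      (∀ i, a i + b i = (sv i : ℝ) / ((∑ k, sv k : ℕ) : ℝ)) ∧
      ∑ i, a i = (N : ℝ) / ((∑ k, sv k : ℕ) : ℝ) ∧
      ∑ i, (a i * α (.u i) true + b i * α (.u i) false) < ε := by
  have hτ := MDP.tau_isDistr (subMDP_isValid hT hN) hα
  set x := d .s .t
  have hs := MDP.tau_eq_of_phi hα (x := .s) rfl rfl
  have ht := MDP.tau_eq_of_phi hα (x := .t) rfl rfl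
  have step : ∀ {p q z}, subLabel n p = subLabel n q → (subMDP n sv N).tau α q = dirac z →
      ∑ u, (subMDP n sv N).tau α p u * d u z ≤ d p q := fun h₁ h₂ =>
    (MDP.sum_le_Delta_of_tau_eq_dirac hτ h₁ h₂).trans (congrFun (congrFun hd _) _).le
  have ne_label : ∀ {p q}, subLabel n p ≠ subLabel n q → d p q = 1 := fun {p q} h => by
    rw [← hd]
    exact if_pos h
  have haa : x ≤ d .sa .ta := by
    have := step (p := .sa) (q := .ta) rfl (MDP.tau_eq_of_phi hα rfl rfl)
    rw [MDP.tau_eq_of_phi hα (x := .sa) rfl rfl] at this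
    simpa [dirac] using this
  have hbb : x ≤ d .sb .tb := by
    have := step (p := .sb) (q := .tb) rfl (MDP.tau_eq_of_phi hα rfl rfl)
    rw [MDP.tau_eq_of_phi hα (x := .sb) rfl rfl] at this
    simpa [dirac] using this
  have hab : d .sa .tb = 1 := ne_label (by simp [subLabel])
  have hba : d .sb .ta = 1 := ne_label (by simp [subLabel])
  have hu : ∀ i, (0 ≤ α (.u i) false ∧ 0 ≤ α (.u i) true) ∧
      α (.u i) false + α (.u i) true = 1 := fun i => by
    obtain ⟨h₀, h₁, -⟩ := hα (.u i)
    rw [Fintype.sum_bool, add_comm] at h₁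
    exact ⟨⟨h₀ _, h₀ _⟩, h₁⟩
  have hu1 : ∀ i, x + (1 - x) * α (.u i) true ≤ d (.u i) .t1 := fun i => by
    have := step (p := .u i) (q := .t1) rfl (MDP.tau_eq_of_phi hα rfl rfl)
    rw [tau_subMDP_u] at this
    simp only [dirac, add_mul, Finset.sum_add_distrib, mul_ite, mul_one, mul_zero, ite_mul,
      zero_mul, Finset.sum_ite_eq', Finset.mem_univ, if_true, hba] at this
    nlinarith [hu i, mul_le_mul_of_nonneg_left haa (hu i).1.1]
  have hu2 : ∀ i, x + (1 - x) * α (.u i) false ≤ d (.u i) .t2 := fun i => by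
    have := step (p := .u i) (q := .t2) rfl (MDP.tau_eq_of_phi hα rfl rfl)
    rw [tau_subMDP_u] at this
    simp only [dirac, add_mul, Finset.sum_add_distrib, mul_ite, mul_one, mul_zero, ite_mul,
      zero_mul, Finset.sum_ite_eq', Finset.mem_univ, if_true, hab] at this
    nlinarith [hu i, mul_le_mul_of_nonneg_left hbb (hu i).1.2]
  have hx1 : 0 < 1 - x := sub_pos.2 hlt
  obtain ⟨ω, hω, hcost⟩ := MDP.exists_isCoupling_lt (D := subMDP n sv N) (d := d) (x := .s)
    (y := .t) (r := x + (1 - x) * ε) hτ rfl (by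
      rw [hd]
      exact lt_add_of_pos_right _ (mul_pos hx1 hε))
  have row : ∀ i (g : SubState n → ℝ), ∑ v, ω (.u i) v * g v =
      ω (.u i) .t1 * g .t1 + ω (.u i) .t2 * g .t2 := fun i g => by
    have h₀ : ∀ {v}, (subMDP n sv N).tau α .t v = 0 → ω (.u i) v = 0 :=
      fun h => hω.eq_zero_right h _
    rw [ht] at h₀
    rw [SubState.sum_univ, Finset.sum_eq_zero fun j _ => by rw [h₀ (v := .u j) rfl, zero_mul]]
    simp [h₀ (v := .s) rfl, h₀ (v := .sa) rfl, h₀ (v := .sb) rfl, h₀ (v := .t) rfl,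
      h₀ (v := .ta) rfl, h₀ (v := .tb) rfl]
  have outer : ∀ g : SubState n → SubState n → ℝ,
      ∑ u, ∑ v, ω u v * g u v = ∑ i, ∑ v, ω (.u i) v * g (.u i) v := fun g => by
    have h₀ : ∀ {u}, (subMDP n sv N).tau α .s u = 0 → ∀ v, ω u v = 0 :=
      fun h => hω.eq_zero_left h
    rw [hs] at h₀
    rw [SubState.sum_univ]
    simp [h₀ (u := .s) rfl, h₀ (u := .sa) rfl, h₀ (u := .sb) rfl, h₀ (u := .t) rfl,
      h₀ (u := .t1) rfl, h₀ (u := .t2) rfl, h₀ (u := .ta) rfl, h₀ (u := .tb) rfl]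
  have hrow : ∀ i, ω (.u i) .t1 + ω (.u i) .t2 = (sv i : ℝ) / ((∑ k, sv k : ℕ) : ℝ) := fun i => by
    have := hω.2.1 (.u i)
    have h₂ := row i fun _ => 1
    simp only [mul_one] at h₂
    rw [← h₂, this, hs]
  have hcol : ∑ i, ω (.u i) .t1 = (N : ℝ) / ((∑ k, sv k : ℕ) : ℝ) := by
    have h₂ := outer fun _ v => if v = .t1 then 1 else 0
    simp only [mul_ite, mul_one, mul_zero, Finset.sum_ite_eq', Finset.mem_univ, if_true] at h₂
    rw [← h₂, hω.2.2, ht]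
  refine ⟨fun i => ω (.u i) .t1, fun i => ω (.u i) .t2, fun i => hω.1 _ _, fun i => hω.1 _ _,
    hrow, hcol, ?_⟩
  have htotal : ∑ i, (ω (.u i) .t1 + ω (.u i) .t2) = 1 := by
    rw [Finset.sum_congr rfl fun i _ => hrow i, ← Finset.sum_div, ← Nat.cast_sum, div_self]
    exact_mod_cast hT.ne'
  have hbound : x + (1 - x) * ∑ i, (ω (.u i) .t1 * α (.u i) true + ω (.u i) .t2 * α (.u i) false) ≤
      ∑ u, ∑ v, ω u v * d u v := by
    rw [outer]
    calc _ = ∑ i, (x * (ω (.u i) .t1 + ω (.u i) .t2) +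
          (1 - x) * (ω (.u i) .t1 * α (.u i) true + ω (.u i) .t2 * α (.u i) false)) := by
          rw [Finset.sum_add_distrib (f := fun i => x * _), ← Finset.mul_sum, ← Finset.mul_sum, htotal,
            mul_one]
      _ ≤ _ := Finset.sum_le_sum fun i _ => by
          rw [row]
          nlinarith [mul_le_mul_of_nonneg_left (hu1 i) (hω.1 (.u i) .t1),
            mul_le_mul_of_nonneg_left (hu2 i) (hω.1 (.u i) .t2)]
  have := hbound.trans_lt hcost
  exact lt_of_mul_lt_mul_left (by linarith) hx1.le

/-- Rounding: a fractional split of the weights whose disagreement with `p` is small comes from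
an integral one. -/
theorem exists_subset_sum_eq_of_split (hT : 0 < ∑ i, sv i) {a b p q : Fin n → ℝ}
    (ha : ∀ i, 0 ≤ a i) (hb : ∀ i, 0 ≤ b i) (hp : ∀ i, 0 ≤ p i) (hq : ∀ i, 0 ≤ q i)
    (hpq : ∀ i, p i + q i = 1)
    (hab : ∀ i, a i + b i = (sv i : ℝ) / ((∑ k, sv k : ℕ) : ℝ))
    (hN : ∑ i, a i = (N : ℝ) / ((∑ k, sv k : ℕ) : ℝ))
    (hcost : ∑ i, (a i * q i + b i * p i) < 1 / (2 * ((∑ k, sv k : ℕ) : ℝ))) :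
    ∃ P : Finset (Fin n), ∑ i ∈ P, sv i = N := by
  have hT' : (0 : ℝ) < ((∑ i, sv i : ℕ) : ℝ) := by exact_mod_cast hT
  set T : ℝ := ((∑ i, sv i : ℕ) : ℝ)
  refine ⟨Finset.univ.filter fun i => 1 / 2 ≤ p i, ?_⟩
  have hdiff : (((∑ i ∈ Finset.univ.filter fun i => 1 / 2 ≤ p i, sv i : ℕ) : ℝ) - N) / T =
      ∑ i, ((if 1 / 2 ≤ p i then a i + b i else 0) - a i) := by
    rw [Finset.sum_sub_distrib, hN, ← Finset.sum_filter, Finset.sum_congr rfl fun i _ => hab i,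
      ← Finset.sum_div, sub_div, Nat.cast_sum]
  have habs : |(((∑ i ∈ Finset.univ.filter fun i => 1 / 2 ≤ p i, sv i : ℕ) : ℝ) - N) / T| <
      1 / T := by
    rw [hdiff]
    calc _ ≤ ∑ i, |(if 1 / 2 ≤ p i then a i + b i else 0) - a i| :=
          Finset.abs_sum_le_sum_abs _ _
      _ ≤ ∑ i, 2 * (a i * q i + b i * p i) := Finset.sum_le_sum fun i _ => by
          have := mul_nonneg (ha i) (hq i)
          have := mul_nonneg (hb i) (hp i)
          split_ifs with h
          · rw [add_sub_cancel_left, abs_of_nonneg (hb i)]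
            nlinarith [hb i]
          · rw [zero_sub, abs_neg, abs_of_nonneg (ha i)]
            nlinarith [ha i, hpq i]
      _ = 2 * ∑ i, (a i * q i + b i * p i) := by rw [Finset.mul_sum]
      _ < 2 * (1 / (2 * T)) := by linarith
      _ = 1 / T := by field_simp
  rw [abs_div, abs_of_pos hT', div_lt_div_iff_of_pos_right hT'] at habs
  have : |((∑ i ∈ Finset.univ.filter fun i => 1 / 2 ≤ p i, sv i : ℕ) : ℤ) - (N : ℤ)| < 1 := by
    exact_mod_cast habs
  have := Int.abs_lt_one_iff.1 this
  omega

end SubsetSum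

/-- there is a subset `P ⊆ {1,…,n}` with `Σ_{i∈P} sᵢ = N` iff there
is a memoryless strategy `α` such that the probabilistic bisimilarity distance
satisfies `d_pb(s,t) < 1` in `D(α)`. -/
theorem subsetSum_iff_exists_strategy_dpb_lt_one
    (n : ℕ) (hn : 1 ≤ n) (sv : Fin n → ℕ) (hsv : ∀ i, 0 < sv i)
    (N : ℕ) (hN : N ≤ ∑ i, sv i) :
    (∃ P : Finset (Fin n), (∑ i ∈ P, sv i) = N) ↔
      ∃ α, (subMDP n sv N).IsStrategy α ∧
        ∃ d, (subMDP n sv N).IsBisimDist α d ∧ d SubState.s SubState.t < 1 := by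
  have hT := sum_pos_of_forall_pos hn hsv
  constructor
  · rintro ⟨P, hP⟩
    have hα := subMDP_isStrategy_mdStrat (sv := sv) (N := N) P
    have hτ := MDP.tau_isDistr (subMDP_isValid hT hN) hα
    obtain ⟨d, hd, hle⟩ := MDP.exists_isBisimDist hτ
    refine ⟨_, hα, d, hd, ?_⟩
    have := hle (fun x y => if subClass P x = subClass P y then 0 else 1)
      (fun x y => by split_ifs <;> simp)
      (MDP.Delta_le_of_fiber_sum_eq hτ (subClass P) (subLabel_eq_of_subClass_eq P)
        fun x y hxy k => by
          rw [fiber_sum_tau_mdStrat hT hP, fiber_sum_tau_mdStrat hT hP, hxy]) .s .t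
    exact (this.trans_eq (if_pos rfl)).trans_lt one_pos
  · rintro ⟨α, hα, d, hd, hlt⟩
    have hT' : (0 : ℝ) < ((∑ i, sv i : ℕ) : ℝ) := by exact_mod_cast hT
    obtain ⟨a, b, ha, hb, hab, ha_sum, hcost⟩ := exists_split_lt hT hN hα hd.2.1 hlt
      (ε := 1 / (2 * ((∑ k, sv k : ℕ) : ℝ))) (by positivity)
    refine exists_subset_sum_eq_of_split hT ha hb (fun i => (hα (.u i)).1 false)
      (fun i => (hα (.u i)).1 true) (fun i => ?_) hab ha_sum hcost
    rw [add_comm, ← Fintype.sum_bool, (hα (.u i)).2.1]
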